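/- arXiv:1008.3769 — 2 statements merged into one kernel-verified Lean document; each statement's English description precedes it below -/
import Mathlib

section
/- Let N ≥ 5 and k ≥ 1. Define, for x ∈ T_N^d, the hypercube Q_x = {z ∈ T_N^d : z_i − x_i ∈ {0,1} for all 1 ≤ i ≤ d}, and let Σ*_{N,k} = {η : Σ_{x} η(x) = k and there exists x ∈ T_N^d with η(z) ≥ 1 for all z ∈ Q_x}. Then any two configurations η, ξ ∈ Σ*_{N,k} are mutually reachable through allowed jumps; in particular, Σ*_{N,k} is contained in a single irreducible component of the hyperplane Σ_{N,k} = {η : Σ_x η(x) = k}. -/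
/-!
STATEMENT 5: Any two configurations in Σ*_{N,k} (k particles, at least one
fully occupied hypercube of linear size 2) are mutually reachable through
allowed jumps.
-/

open scoped BigOperators

/-- Distance on the discrete torus `(ℤ/Nℤ)^d` induced by the sum norm. -/
def torusDist {d N : ℕ} (x y : Fin d → ZMod N) : ℕ :=
  ∑ i, min (x i - y i).val (y i - x i).val

/-- The exchange rate `c(x,y,η) = g(η(2x−y)) + g(η(2y−x))`. -/
noncomputable def rate {d N : ℕ} (g : ℕ → ℝ) (x y : Fin d → ZMod N)
    (η : (Fin d → ZMod N) → ℕ) : ℝ :=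
  g (η (2 • x - y)) + g (η (2 • y - x))

/-- The configuration after a particle jumps from `x` to `y`. -/
def jump {d N : ℕ} (η : (Fin d → ZMod N) → ℕ) (x y : Fin d → ZMod N) :
    (Fin d → ZMod N) → ℕ :=
  Function.update (Function.update η x (η x - 1)) y (η y + 1)

/-- One allowed jump of the dynamics. -/
noncomputable def AllowedStep {d N : ℕ} (g : ℕ → ℝ)
    (η ξ : (Fin d → ZMod N) → ℕ) : Prop :=
  ∃ x y : Fin d → ZMod N, torusDist x y = 1 ∧
    0 < rate g x y η * g (η x) ∧ ξ = jump η x y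

/-- `ξ` is reachable from `η` through allowed jumps. -/
noncomputable def Reachable {d N : ℕ} (g : ℕ → ℝ)
    (η ξ : (Fin d → ZMod N) → ℕ) : Prop :=
  Relation.ReflTransGen (AllowedStep g) η ξ

/-- `η` contains a fully occupied hypercube of linear size 2, i.e.
a site `x` with `η(z) ≥ 1` for every `z` whose coordinates satisfy
`z_i − x_i ∈ {0,1}`. -/
def HasMobileCluster {d N : ℕ} (η : (Fin d → ZMod N) → ℕ) : Prop :=
  ∃ x : Fin d → ZMod N, ∀ z : Fin d → ZMod N,
    (∀ i, z i = x i ∨ z i = x i + 1) → 1 ≤ η z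

section Irreducibility

variable {d N : ℕ}

lemma rate_pos {g : ℕ → ℝ} (hg_nonneg : ∀ k, 0 ≤ g k) (hg_zero : ∀ k, g k = 0 ↔ k = 0)
    {x y : Fin d → ZMod N} {η : (Fin d → ZMod N) → ℕ} :
    0 < rate g x y η ↔ η (2 • x - y) ≠ 0 ∨ η (2 • y - x) ≠ 0 := by
  have h₁ := hg_nonneg (η (2 • x - y))
  have h₂ := hg_nonneg (η (2 • y - x))
  rw [Ne, Ne, ← hg_zero, ← hg_zero, rate]
  constructor
  · intro h
    by_contra! h'
    linarith [h'.1, h'.2]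
  · rintro (h | h)
    · linarith [lt_of_le_of_ne h₁ (Ne.symm h)]
    · linarith [lt_of_le_of_ne h₂ (Ne.symm h)]

lemma rate_mul_pos {g : ℕ → ℝ} (hg_nonneg : ∀ k, 0 ≤ g k) (hg_zero : ∀ k, g k = 0 ↔ k = 0)
    {x y : Fin d → ZMod N} {η : (Fin d → ZMod N) → ℕ} :
    0 < rate g x y η * g (η x) ↔
      (η (2 • x - y) ≠ 0 ∨ η (2 • y - x) ≠ 0) ∧ η x ≠ 0 := by
  have h₂ := hg_nonneg (η x)
  have h₁ : 0 ≤ rate g x y η := add_nonneg (hg_nonneg _) (hg_nonneg _)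
  rw [← rate_pos hg_nonneg hg_zero, Ne, ← hg_zero]
  constructor
  · intro h
    exact ⟨pos_of_mul_pos_left h h₂, fun h' => by simp [h'] at h⟩
  · rintro ⟨h, h'⟩
    exact mul_pos h (lt_of_le_of_ne h₂ (Ne.symm h'))

lemma torusDist_self (x : Fin d → ZMod N) : torusDist x x = 0 := by
  simp [torusDist]

lemma torusDist_comm (x y : Fin d → ZMod N) : torusDist x y = torusDist y x := by
  simp only [torusDist, min_comm]

lemma torusDist_add_single (hN : 1 < N) (x : Fin d → ZMod N) (i : Fin d) :
    torusDist x (x + Pi.single i 1) = 1 := by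
  have : Fact (1 < N) := ⟨hN⟩
  unfold torusDist
  rw [Finset.sum_eq_single i]
  · have h : (-1 : ZMod N).val ≠ 0 := by simp [ZMod.val_eq_zero]
    simp only [Pi.add_apply, Pi.single_eq_same, sub_add_cancel_left, add_sub_cancel_left,
      ZMod.val_one]
    omega
  · intro j _ hj
    simp [hj]
  · simp

lemma AllowedStep.add_right {g : ℕ → ℝ} (hg_nonneg : ∀ k, 0 ≤ g k)
    (hg_zero : ∀ k, g k = 0 ↔ k = 0) {η ξ : (Fin d → ZMod N) → ℕ}
    (h : AllowedStep g η ξ) (ζ : (Fin d → ZMod N) → ℕ) : AllowedStep g (η + ζ) (ξ + ζ) := by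
  obtain ⟨x, y, hxy, hr, rfl⟩ := h
  rw [rate_mul_pos hg_nonneg hg_zero] at hr
  refine ⟨x, y, hxy, ?_, ?_⟩
  · rw [rate_mul_pos hg_nonneg hg_zero]
    simp only [Pi.add_apply]
    omega
  · funext z
    have hx := hr.2
    simp only [jump, Function.update_apply, Pi.add_apply]
    split_ifs <;> subst_vars <;> omega

lemma Reachable.add_right {g : ℕ → ℝ} (hg_nonneg : ∀ k, 0 ≤ g k)
    (hg_zero : ∀ k, g k = 0 ↔ k = 0) {η ξ : (Fin d → ZMod N) → ℕ}
    (h : Reachable g η ξ) (ζ : (Fin d → ZMod N) → ℕ) : Reachable g (η + ζ) (ξ + ζ) :=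
  Relation.ReflTransGen.lift (p := AllowedStep g) (· + ζ)
    (fun _ _ h => AllowedStep.add_right hg_nonneg hg_zero h ζ) _ _ h

lemma Reachable.add {g : ℕ → ℝ} (hg_nonneg : ∀ k, 0 ≤ g k)
    (hg_zero : ∀ k, g k = 0 ↔ k = 0) {η ξ η' ξ' : (Fin d → ZMod N) → ℕ}
    (h : Reachable g η ξ) (h' : Reachable g η' ξ') : Reachable g (η + η') (ξ + ξ') := by
  refine (h.add_right hg_nonneg hg_zero η').trans ?_
  rw [add_comm ξ, add_comm ξ]
  exact h'.add_right hg_nonneg hg_zero ξ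

/-- Mutual reachability is an additive congruence on configurations. -/
def mutualReachCon (g : ℕ → ℝ) (hg_nonneg : ∀ k, 0 ≤ g k) (hg_zero : ∀ k, g k = 0 ↔ k = 0) :
    AddCon ((Fin d → ZMod N) → ℕ) where
  r η ξ := Reachable g η ξ ∧ Reachable g ξ η
  iseqv :=
    { refl := fun _ => ⟨.refl, .refl⟩
      symm := fun h => ⟨h.2, h.1⟩
      trans := fun h h' => ⟨h.1.trans h'.1, h'.2.trans h.2⟩ }
  add' := fun h h' => ⟨h.1.add hg_nonneg hg_zero h'.1, h.2.add hg_nonneg hg_zero h'.2⟩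

lemma reachable_single_add_single {g : ℕ → ℝ} (hg_nonneg : ∀ k, 0 ≤ g k)
    (hg_zero : ∀ k, g k = 0 ↔ k = 0) {x y w : Fin d → ZMod N} (hxy : torusDist x y = 1)
    (hw : w = 2 • x - y ∨ w = 2 • y - x) :
    Reachable g (Pi.single w 1 + Pi.single x 1) (Pi.single w 1 + Pi.single y 1) := by
  have hne : x ≠ y := by
    rintro rfl
    simp [torusDist_self] at hxy
  refine Relation.ReflTransGen.single ⟨x, y, hxy, ?_, ?_⟩
  · rw [rate_mul_pos hg_nonneg hg_zero]
    rcases hw with rfl | rfl <;> simp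
  · funext z
    simp only [jump, Function.update_apply, Pi.add_apply, Pi.single_apply]
    split_ifs <;> simp_all

/-- The corner of the hypercube `Q_x` indexed by the set `t` of shifted coordinates. -/
def corner (x : Fin d → ZMod N) (t : Finset (Fin d)) : Fin d → ZMod N :=
  x + fun j => if j ∈ t then 1 else 0

lemma corner_empty (x : Fin d → ZMod N) : corner x ∅ = x := by
  funext j
  simp [corner]

lemma corner_add (x y : Fin d → ZMod N) (t : Finset (Fin d)) :
    corner (x + y) t = corner x t + y := by
  simp only [corner, add_right_comm]

lemma corner_insert (x : Fin d → ZMod N) {i : Fin d} {t : Finset (Fin d)} (hi : i ∉ t) :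
    corner x (insert i t) = corner x t + Pi.single i 1 := by
  funext j
  by_cases hj : j = i
  · subst hj
    simp [corner, hi]
  · simp [corner, hj]

lemma corner_injective (hN : 1 < N) (x : Fin d → ZMod N) : Function.Injective (corner x) := by
  have : Fact (1 < N) := ⟨hN⟩
  intro s t h
  ext j
  have hj := congrFun h j
  simp only [corner, Pi.add_apply, add_right_inj] at hj
  by_cases hs : j ∈ s <;> by_cases ht : j ∈ t <;> simp_all

/-- The configuration with one particle at each site of `Q_x`. -/
def cubeConfig (x : Fin d → ZMod N) : (Fin d → ZMod N) → ℕ :=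
  ∑ t : Finset (Fin d), Pi.single (corner x t) 1

lemma cubeConfig_le (hN : 1 < N) {η : (Fin d → ZMod N) → ℕ} {x : Fin d → ZMod N}
    (h : ∀ z : Fin d → ZMod N, (∀ i, z i = x i ∨ z i = x i + 1) → 1 ≤ η z) :
    cubeConfig x ≤ η := by
  intro z
  rw [cubeConfig, Finset.sum_apply]
  by_cases hz : ∃ t, corner x t = z
  · obtain ⟨t, rfl⟩ := hz
    rw [Finset.sum_eq_single t]
    · simp only [Pi.single_eq_same]
      refine h _ fun i => ?_
      by_cases hi : i ∈ t <;> simp [corner, hi]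
    · intro s _ hs
      exact Pi.single_eq_of_ne (fun h => hs (corner_injective hN x h.symm)) _
    · simp
  · rw [Finset.sum_eq_zero]
    · exact Nat.zero_le _
    · intro t _
      exact Pi.single_eq_of_ne (fun h => hz ⟨t, h.symm⟩) _

lemma sum_cubeConfig [NeZero N] (x : Fin d → ZMod N) : ∑ z, cubeConfig x z = 2 ^ d := by
  simp only [cubeConfig, Finset.sum_apply]
  rw [Finset.sum_comm]
  simp [Pi.single_apply]

lemma eq_of_forall_add_single [NeZero N] {α : Type*} {f : (Fin d → ZMod N) → α}
    (h : ∀ x i, f (x + Pi.single i 1) = f x) (x y : Fin d → ZMod N) : f x = f y := by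
  let S : AddSubmonoid (Fin d → ZMod N) :=
    { carrier := {v | ∀ x, f (x + v) = f x}
      zero_mem' := fun x => by rw [add_zero]
      add_mem' := fun {a b} ha hb x => by rw [← add_assoc, hb, ha] }
  have hS : ∀ v, v ∈ S := by
    intro v
    rw [← Finset.univ_sum_single v]
    refine S.sum_mem fun i _ => ?_
    have hv : (Pi.single i (v i) : Fin d → ZMod N) = (v i).val • Pi.single i 1 := by
      rw [← Pi.single_smul]
      simp
    rw [hv]
    exact S.nsmul_mem (fun x => h x i) _
  have hxy := hS (y - x) x
  rw [add_sub_cancel] at hxy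
  exact hxy.symm

section Quotient

variable {M : Type*} [AddCommMonoid M] {φ : ((Fin d → ZMod N) → ℕ) →+ M}

lemma map_cubeConfig_eq [NeZero N]
    (hmove : ∀ z i, φ (Pi.single z 1) + φ (Pi.single (z + Pi.single i 1) 1) =
      φ (Pi.single (z + Pi.single i 1) 1) + φ (Pi.single (z + Pi.single i 1 + Pi.single i 1) 1))
    (x y : Fin d → ZMod N) :
    φ (cubeConfig x) = φ (cubeConfig y) := by
  refine eq_of_forall_add_single (f := fun x => φ (cubeConfig x)) (fun x i => ?_) x y
  simp only [cubeConfig, map_sum]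
  rw [← Finset.powerset_univ, ← Finset.insert_erase (Finset.mem_univ i),
    Finset.sum_powerset_insert (Finset.notMem_erase i _),
    Finset.sum_powerset_insert (Finset.notMem_erase i _), ← Finset.sum_add_distrib,
    ← Finset.sum_add_distrib]
  refine Finset.sum_congr rfl fun t ht => ?_
  have hi : i ∉ t := fun h => Finset.notMem_erase i _ (Finset.mem_powerset.1 ht h)
  rw [corner_insert _ hi, corner_insert _ hi, corner_add]
  exact (hmove _ i).symm

lemma map_cubeConfig_add_single_eq [NeZero N]
    (hfix : ∀ z i, φ (Pi.single z 1) + φ (Pi.single (z + Pi.single i 1) 1) =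
      φ (Pi.single z 1) + φ (Pi.single (z + Pi.single i 1 + Pi.single i 1) 1))
    (hmove : ∀ z i, φ (Pi.single z 1) + φ (Pi.single (z + Pi.single i 1) 1) =
      φ (Pi.single (z + Pi.single i 1) 1) + φ (Pi.single (z + Pi.single i 1 + Pi.single i 1) 1))
    (x a b : Fin d → ZMod N) :
    φ (cubeConfig x) + φ (Pi.single a 1) = φ (cubeConfig x) + φ (Pi.single b 1) := by
  refine eq_of_forall_add_single (f := fun a => φ (cubeConfig x) + φ (Pi.single a 1))
    (fun a i => ?_) a b
  obtain ⟨z, rfl⟩ : ∃ z, a = z + Pi.single i 1 := ⟨a - Pi.single i 1, by simp⟩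
  rw [map_cubeConfig_eq hmove x z]
  simp only [cubeConfig, map_sum]
  rw [← Finset.sum_erase_add _ _ (Finset.mem_univ (∅ : Finset (Fin d))), corner_empty,
    add_assoc (∑ t ∈ _, _), add_assoc (∑ t ∈ _, _), hfix]

lemma map_cubeConfig_add_eq [NeZero N]
    (hfix : ∀ z i, φ (Pi.single z 1) + φ (Pi.single (z + Pi.single i 1) 1) =
      φ (Pi.single z 1) + φ (Pi.single (z + Pi.single i 1 + Pi.single i 1) 1))
    (hmove : ∀ z i, φ (Pi.single z 1) + φ (Pi.single (z + Pi.single i 1) 1) =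
      φ (Pi.single (z + Pi.single i 1) 1) + φ (Pi.single (z + Pi.single i 1 + Pi.single i 1) 1))
    (x : Fin d → ZMod N) (ζ : (Fin d → ZMod N) → ℕ) :
    φ (cubeConfig x) + φ ζ = φ (cubeConfig x) + (∑ z, ζ z) • φ (Pi.single 0 1) := by
  have hn : ∀ (n : ℕ) (a : Fin d → ZMod N), φ (cubeConfig x) + n • φ (Pi.single a 1) =
      φ (cubeConfig x) + n • φ (Pi.single 0 1) := by
    intro n a
    induction n with
    | zero => simp
    | succ n ih =>
      rw [succ_nsmul, succ_nsmul, ← add_assoc, ih, add_right_comm,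
        map_cubeConfig_add_single_eq hfix hmove x a 0, add_right_comm, add_assoc]
  have hs : ∀ s : Finset (Fin d → ZMod N),
      φ (cubeConfig x) + ∑ z ∈ s, ζ z • φ (Pi.single z 1) =
        φ (cubeConfig x) + (∑ z ∈ s, ζ z) • φ (Pi.single 0 1) := by
    intro s
    induction s using Finset.induction_on with
    | empty => simp
    | insert a s ha ih =>
      rw [Finset.sum_insert ha, Finset.sum_insert ha, add_left_comm, ih, add_left_comm,
        ← add_assoc, hn, add_assoc, ← add_smul]
  rw [← hs]
  congr 1
  conv_lhs => rw [← Finset.univ_sum_single ζ]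
  rw [map_sum]
  refine Finset.sum_congr rfl fun z _ => ?_
  rw [← map_nsmul, ← Pi.single_smul]
  simp

end Quotient

end Irreducibility

theorem sigma_star_irreducible
    (d N : ℕ) [NeZero N] (hd : 1 ≤ d) (hN : 5 ≤ N)
    (g : ℕ → ℝ) (hg_nonneg : ∀ k, 0 ≤ g k) (hg_zero : ∀ k, g k = 0 ↔ k = 0)
    (k : ℕ) (hk : 1 ≤ k)
    (η ξ : (Fin d → ZMod N) → ℕ)
    (hηk : (∑ x : Fin d → ZMod N, η x) = k)
    (hξk : (∑ x : Fin d → ZMod N, ξ x) = k)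
    (hη : HasMobileCluster η) (hξ : HasMobileCluster ξ) :
    Reachable g η ξ ∧ Reachable g ξ η := by
  let R : AddCon ((Fin d → ZMod N) → ℕ) := mutualReachCon g hg_nonneg hg_zero
  have hdist : ∀ (z : Fin d → ZMod N) i, torusDist z (z + Pi.single i 1) = 1 :=
    torusDist_add_single (by omega)
  have hfix : ∀ z i, R.mk' (Pi.single z 1) + R.mk' (Pi.single (z + Pi.single i 1) 1) =
      R.mk' (Pi.single z 1) + R.mk' (Pi.single (z + Pi.single i 1 + Pi.single i 1) 1) := by
    intro z i
    rw [← map_add, ← map_add]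
    exact R.eq.2
      ⟨reachable_single_add_single hg_nonneg hg_zero (hdist _ i) (.inl (by abel)),
        reachable_single_add_single hg_nonneg hg_zero
          ((torusDist_comm _ _).trans (hdist _ i)) (.inr (by abel))⟩
  have hslide : ∀ z i,
      R.mk' (Pi.single (z + Pi.single i 1 + Pi.single i 1) 1) + R.mk' (Pi.single z 1) =
        R.mk' (Pi.single (z + Pi.single i 1 + Pi.single i 1) 1) +
          R.mk' (Pi.single (z + Pi.single i 1) 1) := by
    intro z i
    rw [← map_add, ← map_add]
    exact R.eq.2
      ⟨reachable_single_add_single hg_nonneg hg_zero (hdist _ i) (.inr (by abel)),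
        reachable_single_add_single hg_nonneg hg_zero
          ((torusDist_comm _ _).trans (hdist _ i)) (.inl (by abel))⟩
  have hmove : ∀ z i, R.mk' (Pi.single z 1) + R.mk' (Pi.single (z + Pi.single i 1) 1) =
      R.mk' (Pi.single (z + Pi.single i 1) 1) +
        R.mk' (Pi.single (z + Pi.single i 1 + Pi.single i 1) 1) := by
    intro z i
    rw [hfix, add_comm, hslide, add_comm]
  have key : ∀ ζ : (Fin d → ZMod N) → ℕ, (∑ x, ζ x) = k → HasMobileCluster ζ →
      R.mk' ζ = R.mk' (cubeConfig 0) + (k - 2 ^ d) • R.mk' (Pi.single 0 1) := by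
    rintro ζ hζk ⟨x, hx⟩
    obtain ⟨ω, rfl⟩ := exists_add_of_le (cubeConfig_le (by omega) hx)
    simp only [Pi.add_apply, Finset.sum_add_distrib, sum_cubeConfig] at hζk
    rw [map_add, map_cubeConfig_add_eq hfix hmove, map_cubeConfig_eq hmove x 0, ← hζk,
      Nat.add_sub_cancel_left]
  exact R.eq.1 ((key η hηk hη).trans (key ξ hξk hξ).symm)
end

section
/- Let T > 0, let F : [0,T] × T^d → ℝ be bounded, and let ρ : [0,T] × T^d → ℝ satisfy δ₀ ≤ ρ(s,u) ≤ δ₁ for all (s,u), where 0 < δ₀ ≤ δ₁ < ∞. Then there exists γ₁ > 0 such that for all 0 < γ < γ₁, sup over (s,u) ∈ [0,T] × T^d and λ ≥ 0 of { γ·F(s,u)·M(λ, ρ(s,u)) − J_{ρ(s,u)}(λ) } ≤ 0. -/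
/-!
STATEMENT 15: For bounded F and δ₀ ≤ ρ ≤ δ₁, there is γ₁ > 0 such that for all
0 < γ < γ₁: sup_{(s,u),λ≥0} { γ·F(s,u)·M(λ,ρ(s,u)) − J_{ρ(s,u)}(λ) } ≤ 0.
-/

open scoped BigOperators

/-- `g(k)! = g(1)⋯g(k)`, with `g(0)! = 1`. -/
noncomputable def gFact (g : ℕ → ℝ) (k : ℕ) : ℝ := ∏ j ∈ Finset.Icc 1 k, g j

/-- The partition function `Z(ψ) = Σ_k ψ^k / g(k)!`. -/
noncomputable def partZ (g : ℕ → ℝ) (ψ : ℝ) : ℝ := ∑' k : ℕ, ψ ^ k / gFact g k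

/-- The mean particle number per site `R(ψ)` under `ν̄_ψ`. -/
noncomputable def meanR (g : ℕ → ℝ) (ψ : ℝ) : ℝ :=
  ∑' k : ℕ, (k : ℝ) * ψ ^ k / (partZ g ψ * gFact g k)

/-- `M(λ,β) = p̃(λ) − p̃(β) − p̃′(β)(λ−β)` with `p̃ = Φ²`, `p̃′ = 2ΦΦ′`. -/
noncomputable def Mfun (Φ Φ' : ℝ → ℝ) (lam β : ℝ) : ℝ :=
  (Φ lam) ^ 2 - (Φ β) ^ 2 - 2 * Φ β * Φ' β * (lam - β)

/-- The rate function `J_β(λ) = λ·log(Φ(λ)/Φ(β)) − log(Z(Φ(λ))/Z(Φ(β)))`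
(with the convention `0·log 0 = 0`, which holds since `Real.log 0 = 0`). -/
noncomputable def Jfun (g : ℕ → ℝ) (Φ : ℝ → ℝ) (β lam : ℝ) : ℝ :=
  lam * Real.log (Φ lam / Φ β) - Real.log (partZ g (Φ lam) / partZ g (Φ β))

open Set Filter Topology

/-! ### Power series with a positive radius of convergence -/

lemma summable_natCast_mul_pow {a : ℕ → ℝ} {s r : ℝ} (ha : ∀ k, 0 ≤ a k) (hs : 0 ≤ s)
    (hsr : s < r) (hsum : Summable fun k => a k * r ^ k) :
    Summable fun k : ℕ => (k : ℝ) * (a k * s ^ k) := by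
  have hr : 0 < r := hs.trans_lt hsr
  have hq : ‖s / r‖ < 1 := by
    rw [Real.norm_of_nonneg (by positivity)]
    exact (div_lt_one hr).2 hsr
  have hgeom := (summable_pow_mul_geometric_of_norm_lt_one 1 hq).tendsto_atTop_zero
  refine summable_of_isBigO_nat hsum (Asymptotics.IsBigO.of_bound 1 ?_)
  filter_upwards [hgeom.eventually (gt_mem_nhds (zero_lt_one' ℝ))] with k hk
  have hak := ha k
  rw [Real.norm_of_nonneg (by positivity), Real.norm_of_nonneg (by positivity), one_mul]
  calc (k : ℝ) * (a k * s ^ k) = ((k : ℝ) ^ 1 * (s / r) ^ k) * (a k * r ^ k) := by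
        rw [div_pow]
        field_simp
    _ ≤ 1 * (a k * r ^ k) := by gcongr
    _ = a k * r ^ k := one_mul _

lemma hasDerivAt_tsum_mul_pow {a : ℕ → ℝ} {x r : ℝ} (ha : ∀ k, 0 ≤ a k) (hx : 0 < x)
    (hxr : x < r) (hsum : Summable fun k => a k * r ^ k) :
    HasDerivAt (fun y => ∑' k, a k * y ^ k) (x⁻¹ * ∑' k : ℕ, (k : ℝ) * (a k * x ^ k)) x := by
  obtain ⟨s, hxs, hsr⟩ := exists_between hxr
  have hs : 0 < s := hx.trans hxs
  have hu := (summable_natCast_mul_pow ha hs.le hsr hsum).mul_left s⁻¹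
  have hpow : ∀ (k : ℕ) {y : ℝ}, y ≠ 0 →
      a k * ((k : ℝ) * y ^ (k - 1)) = y⁻¹ * ((k : ℝ) * (a k * y ^ k)) := by
    intro k y hy
    rcases k with _ | k
    · simp
    · simp only [Nat.add_sub_cancel, pow_succ]
      field_simp
  have hs0 : Summable fun k => a k * (0 : ℝ) ^ k :=
    summable_of_ne_finset_zero (s := {0}) fun k hk => by
      simp only [Finset.mem_singleton] at hk
      simp [hk]
  have := hasDerivAt_tsum_of_isPreconnected (t := Ioo (-s) s)
    (g := fun k y => a k * y ^ k) (g' := fun k y => a k * ((k : ℝ) * y ^ (k - 1)))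
    hu isOpen_Ioo isPreconnected_Ioo (fun k y _ => (hasDerivAt_pow k y).const_mul (a k))
    (fun k y hy => ?_) (y₀ := 0) ⟨by linarith, hs⟩ hs0 (y := x) ⟨by linarith, hxs⟩
  · rwa [tsum_congr fun k => hpow k hx.ne', tsum_mul_left] at this
  · rw [← hpow k hs.ne', norm_mul, norm_mul, norm_pow, Real.norm_of_nonneg (ha k),
      Real.norm_natCast]
    have := abs_le.2 ⟨hy.1.le, hy.2.le⟩
    have := ha k
    gcongr
    assumption

lemma analyticOnNhd_tsum_mul_pow {a : ℕ → ℝ} {r : ℝ} (ha : ∀ k, 0 ≤ a k) (hr : 0 < r)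
    (hsum : Summable fun k => a k * r ^ k) :
    AnalyticOnNhd ℝ (fun y => ∑' k, a k * y ^ k) (Ioo (-r) r) := by
  lift r to NNReal using hr.le
  set p := FormalMultilinearSeries.ofScalars ℝ a
  have hrad : (r : ENNReal) ≤ p.radius := by
    refine p.le_radius_of_summable (hsum.congr fun k => ?_)
    simp [p, abs_of_nonneg (ha k)]
  have hpos : 0 < p.radius :=
    lt_of_lt_of_le (ENNReal.coe_pos.2 (NNReal.coe_pos.1 hr)) hrad
  have hfun : p.sum = fun y => ∑' k, a k * y ^ k := by
    funext y
    simp [p, FormalMultilinearSeries.sum, mul_comm]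
  rw [← hfun]
  intro y hy
  refine (p.hasFPowerSeriesOnBall hpos).analyticAt_of_mem (Metric.eball_subset_eball hrad ?_)
  rw [Metric.mem_eball, edist_zero_right, enorm_eq_nnnorm, ENNReal.coe_lt_coe]
  exact NNReal.coe_lt_coe.1 (by simpa using abs_lt.2 hy)

/-! ### Bregman divergences -/

lemma sq_le_bregman {f f' : ℝ → ℝ} {s : Set ℝ} {c : ℝ} (hs : Convex ℝ s)
    (hf : ∀ x ∈ s, HasDerivAt f (f' x) x)
    (hmono : ∀ x ∈ s, ∀ y ∈ s, x ≤ y → c * (y - x) ≤ f' y - f' x)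
    {x y : ℝ} (hx : x ∈ s) (hy : y ∈ s) :
    c / 2 * (y - x) ^ 2 ≤ f y - f x - f' x * (y - x) := by
  set h : ℝ → ℝ := fun t => f t - f' x * (t - x) - c / 2 * (t - x) ^ 2
  have hder : ∀ t ∈ s, HasDerivAt h (f' t - f' x - c * (t - x)) t := by
    intro t ht
    have hid : HasDerivAt (fun t : ℝ => t - x) 1 t := (hasDerivAt_id t).sub_const x
    refine (((hf t ht).sub (hid.const_mul (f' x))).sub
      ((hid.pow 2).const_mul (c / 2))).congr_deriv ?_
    push_cast
    ring
  suffices h x ≤ h y by simp only [h, sub_self] at this; linarith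
  have hsub : ∀ t ∈ uIcc x y, t ∈ s := fun t ht => hs.ordConnected.uIcc_subset hx hy ht
  rcases le_total x y with hxy | hxy
  · rw [uIcc_of_le hxy] at hsub
    refine monotoneOn_of_deriv_nonneg (convex_Icc x y)
      (fun t ht => (hder t (hsub t ht)).continuousAt.continuousWithinAt)
      (fun t ht => (hder t (hsub t (interior_subset ht))).differentiableAt.differentiableWithinAt)
      (fun t ht => ?_) (left_mem_Icc.2 hxy) (right_mem_Icc.2 hxy) hxy
    have hmem := interior_subset ht
    rw [(hder t (hsub t hmem)).deriv]
    linarith [hmono x hx t (hsub t hmem) hmem.1]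
  · rw [uIcc_of_ge hxy] at hsub
    refine antitoneOn_of_deriv_nonpos (convex_Icc y x)
      (fun t ht => (hder t (hsub t ht)).continuousAt.continuousWithinAt)
      (fun t ht => (hder t (hsub t (interior_subset ht))).differentiableAt.differentiableWithinAt)
      (fun t ht => ?_) (left_mem_Icc.2 hxy) (right_mem_Icc.2 hxy) hxy
    have hmem := interior_subset ht
    rw [(hder t (hsub t hmem)).deriv]
    linarith [hmono t (hsub t hmem) x hx hmem.2]

/-! ### The partition function and the mean particle number -/

lemma gFact_pos {g : ℕ → ℝ} (hg : ∀ k, 0 < g (k + 1)) (k : ℕ) : 0 < gFact g k := by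
  refine Finset.prod_pos fun j hj => ?_
  obtain ⟨i, rfl⟩ := Nat.exists_eq_add_of_le' (Finset.mem_Icc.1 hj).1
  exact hg i

lemma gFact_succ (g : ℕ → ℝ) (k : ℕ) : gFact g (k + 1) = gFact g k * g (k + 1) :=
  Finset.prod_Icc_succ_top (by omega) g

lemma partZ_eq_tsum_mul_pow (g : ℕ → ℝ) :
    partZ g = fun ψ => ∑' k, (gFact g k)⁻¹ * ψ ^ k := by
  funext ψ
  simp only [partZ, div_eq_inv_mul]

lemma one_le_partZ {g : ℕ → ℝ} {ψ : ℝ} (hg : ∀ k, 0 < g (k + 1)) (hψ : 0 ≤ ψ)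
    (hsum : Summable fun k : ℕ => ψ ^ k / gFact g k) : 1 ≤ partZ g ψ := by
  have := hsum.le_tsum 0 fun k _ => div_nonneg (pow_nonneg hψ k) (gFact_pos hg k).le
  simpa [gFact, partZ] using this

lemma partZ_zero (g : ℕ → ℝ) : partZ g 0 = 1 := by
  rw [partZ, tsum_eq_single 0 fun k hk => by simp [hk]]
  simp [gFact]

lemma meanR_zero (g : ℕ → ℝ) : meanR g 0 = 0 := by
  rw [meanR, tsum_congr (g := fun _ => 0) fun k => ?_, tsum_zero]
  rcases k with _ | k <;> simp

lemma partZ_mul_meanR {g : ℕ → ℝ} {ψ : ℝ} (hZ : partZ g ψ ≠ 0) :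
    partZ g ψ * meanR g ψ = ∑' k : ℕ, (k : ℝ) * ((gFact g k)⁻¹ * ψ ^ k) := by
  rw [meanR, ← tsum_mul_left]
  refine tsum_congr fun k => ?_
  rw [mul_div_assoc', mul_div_mul_left _ _ hZ, div_eq_mul_inv]
  ring

lemma hasDerivAt_partZ {g : ℕ → ℝ} {ψ r : ℝ} (hg : ∀ k, 0 < g (k + 1)) (hψ : 0 < ψ)
    (hψr : ψ < r) (hsum : Summable fun k : ℕ => r ^ k / gFact g k) (hZ : partZ g ψ ≠ 0) :
    HasDerivAt (partZ g) (ψ⁻¹ * (partZ g ψ * meanR g ψ)) ψ := by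
  rw [partZ_mul_meanR hZ, partZ_eq_tsum_mul_pow]
  exact hasDerivAt_tsum_mul_pow (fun k => (inv_pos.2 (gFact_pos hg k)).le) hψ hψr
    (by simpa only [div_eq_inv_mul] using hsum)

lemma summable_pow_div_gFact_of_le {g : ℕ → ℝ} {ψ r : ℝ} (hg : ∀ k, 0 < g (k + 1)) (hψ : 0 ≤ ψ)
    (hψr : ψ ≤ r) (hsum : Summable fun k : ℕ => r ^ k / gFact g k) :
    Summable fun k : ℕ => ψ ^ k / gFact g k :=
  hsum.of_nonneg_of_le (fun k => div_nonneg (pow_nonneg hψ k) (gFact_pos hg k).le)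
    fun k => by have := gFact_pos hg k; gcongr

lemma analyticAt_meanR {g : ℕ → ℝ} {ψ r : ℝ} (hg : ∀ k, 0 < g (k + 1)) (hψ : 0 < ψ)
    (hψr : ψ < r) (hsum : Summable fun k : ℕ => r ^ k / gFact g k) :
    AnalyticAt ℝ (meanR g) ψ := by
  have hZpos : ∀ y ∈ Ioo 0 r, partZ g y ≠ 0 := fun y hy => (zero_lt_one.trans_le
    (one_le_partZ hg hy.1.le (summable_pow_div_gFact_of_le hg hy.1.le hy.2.le hsum))).ne'
  have hZ : AnalyticAt ℝ (partZ g) ψ := by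
    rw [partZ_eq_tsum_mul_pow]
    exact analyticOnNhd_tsum_mul_pow (fun k => (inv_pos.2 (gFact_pos hg k)).le) (hψ.trans hψr)
      (by simpa only [div_eq_inv_mul] using hsum) ψ ⟨by linarith, hψr⟩
  refine ((analyticAt_id.mul hZ.deriv).div hZ (hZpos ψ ⟨hψ, hψr⟩)).congr ?_
  filter_upwards [Ioo_mem_nhds hψ hψr] with y hy
  have h1 := hZpos y hy
  have h2 := hy.1.ne'
  simp only [Pi.div_apply, Pi.mul_apply, id,
    (hasDerivAt_partZ hg hy.1 hy.2 hsum h1).deriv]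
  field_simp

/-- Jensen's inequality for `g`, whose mean under the grand canonical measure is `ψ`. -/
lemma sq_le_mul_meanR {g : ℕ → ℝ} {ψ r b : ℝ} (hg : ∀ k, 0 < g (k + 1)) (hg0 : g 0 = 0)
    (hG : ∀ k : ℕ, g k ^ 2 ≤ b * k) (hψ : 0 ≤ ψ) (hψr : ψ < r)
    (hsum : Summable fun k : ℕ => r ^ k / gFact g k) : ψ ^ 2 ≤ b * meanR g ψ := by
  set w : ℕ → ℝ := fun k => (gFact g k)⁻¹ * ψ ^ k with hw
  have hfact := gFact_pos hg
  have hw0 : ∀ k, 0 ≤ w k := fun k => mul_nonneg (inv_pos.2 (hfact k)).le (pow_nonneg hψ k)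
  have hsumψ := summable_pow_div_gFact_of_le hg hψ hψr.le hsum
  have hZ : HasSum w (partZ g ψ) := by
    have := hsumψ.hasSum
    simpa only [hw, ← div_eq_inv_mul, partZ] using this
  have hZ1 := one_le_partZ hg hψ hsumψ
  have hkw : HasSum (fun k : ℕ => (k : ℝ) * w k) (partZ g ψ * meanR g ψ) := by
    rw [partZ_mul_meanR (by positivity)]
    exact (summable_natCast_mul_pow (fun k => (inv_pos.2 (hfact k)).le) hψ hψr
      (by simpa only [div_eq_inv_mul] using hsum)).hasSum
  have hgw : HasSum (fun k => g k * w k) (ψ * partZ g ψ) := by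
    rw [← hasSum_nat_add_iff' 1]
    simp only [Finset.range_one, Finset.sum_singleton, hg0, zero_mul, sub_zero]
    refine (hZ.mul_left ψ).congr_fun fun k => ?_
    have := (hg k).ne'
    have := (hfact k).ne'
    simp only [hw, gFact_succ, pow_succ]
    field_simp
  have hle := hasSum_le (fun k => ?_) (hgw.mul_left (2 * ψ))
    ((hkw.mul_left b).add (hZ.mul_left (ψ ^ 2)))
  · have : partZ g ψ * ψ ^ 2 ≤ partZ g ψ * (b * meanR g ψ) := by linarith
    exact le_of_mul_le_mul_left this (by positivity)
  · nlinarith [mul_le_mul_of_nonneg_right (hG k) (hw0 k),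
      mul_nonneg (sq_nonneg (g k - ψ)) (hw0 k)]

/-! ### The inverse of the mean particle number -/

lemma pos_of_meanR_eq {g : ℕ → ℝ} {ψ α : ℝ} (hψ : 0 ≤ ψ) (hα : 0 < α) (h : meanR g ψ = α) :
    0 < ψ := by
  refine hψ.lt_of_ne fun h0 => ?_
  rw [← h0, meanR_zero] at h
  exact hα.ne h

lemma contDiffOn_inverse_meanR {g : ℕ → ℝ} {Φ Φ' : ℝ → ℝ} (hg : ∀ k, 0 < g (k + 1))
    (hpos : ∀ α, 0 < α → 0 < Φ α)
    (hsum : ∀ α, 0 ≤ α → ∃ r, Φ α < r ∧ Summable fun k : ℕ => r ^ k / gFact g k)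
    (hinv : ∀ α, 0 ≤ α → meanR g (Φ α) = α)
    (hderiv : ∀ α, 0 ≤ α → HasDerivAt Φ (Φ' α) α) (hcont : ContinuousOn Φ' (Ici 0)) :
    ContDiffOn ℝ 1 Φ (Ioi 0) ∧ ContDiffOn ℝ 1 Φ' (Ioi 0) := by
  have hΦ : ContDiffOn ℝ 1 Φ (Ioi 0) := by
    rw [show (1 : WithTop ℕ∞) = 0 + 1 from rfl, contDiffOn_succ_iff_deriv_of_isOpen isOpen_Ioi]
    refine ⟨fun α hα => (hderiv α (le_of_lt hα)).differentiableAt.differentiableWithinAt,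
      by simp, contDiffOn_zero.2 ((hcont.mono Ioi_subset_Ici_self).congr fun α hα => ?_)⟩
    exact (hderiv α (le_of_lt hα)).deriv
  have hanalytic : ∀ α, 0 < α → AnalyticAt ℝ (meanR g) (Φ α) := fun α hα => by
    obtain ⟨r, hr, hs⟩ := hsum α hα.le
    exact analyticAt_meanR hg (hpos α hα) hr hs
  have hprod : ∀ α, 0 < α → deriv (meanR g) (Φ α) * Φ' α = 1 := fun α hα => by
    have hcomp := (hanalytic α hα).differentiableAt.hasDerivAt.comp α (hderiv α hα.le)
    refine hcomp.unique ((hasDerivAt_id α).congr_of_eventuallyEq ?_)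
    filter_upwards [Ioi_mem_nhds hα] with x hx using hinv x (le_of_lt hx)
  refine ⟨hΦ, ContDiffOn.congr (f := fun α => (deriv (meanR g) (Φ α))⁻¹) (fun α hα => ?_)
    fun α hα => eq_inv_of_mul_eq_one_right (hprod α hα)⟩
  have hcd := (hanalytic α hα).deriv.contDiffAt (n := 1)
  exact ((hcd.comp α (hΦ.contDiffAt (Ioi_mem_nhds hα))).inv
    (left_ne_zero_of_mul_eq_one (hprod α hα))).contDiffWithinAt

/-- The thermodynamic entropy is a primitive of `log Φ`. -/
lemma hasDerivAt_entropy {g : ℕ → ℝ} {Φ : ℝ → ℝ} {Φ'α α r : ℝ} (hg : ∀ k, 0 < g (k + 1))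
    (hpos : 0 < Φ α) (hr : Φ α < r) (hsum : Summable fun k : ℕ => r ^ k / gFact g k)
    (hinv : meanR g (Φ α) = α) (hderiv : HasDerivAt Φ Φ'α α) :
    HasDerivAt (fun x => x * Real.log (Φ x) - Real.log (partZ g (Φ x))) (Real.log (Φ α)) α := by
  have hZ : partZ g (Φ α) ≠ 0 := (zero_lt_one.trans_le (one_le_partZ hg hpos.le
    (summable_pow_div_gFact_of_le hg hpos.le hr.le hsum))).ne'
  have hZder := (hasDerivAt_partZ hg hpos hr hsum hZ).comp α hderiv
  refine (((hasDerivAt_id α).mul (hderiv.log hpos.ne')).sub (hZder.log hZ)).congr_deriv ?_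
  simp only [Function.comp_apply, id, hinv]
  field_simp
  ring

lemma Jfun_eq_bregman {g : ℕ → ℝ} {Φ : ℝ → ℝ} {β lam : ℝ} (hβ : 0 < Φ β)
    (hlam : lam = 0 ∨ 0 < Φ lam) (hZβ : 0 < partZ g (Φ β)) (hZlam : 0 < partZ g (Φ lam)) :
    Jfun g Φ β lam = (lam * Real.log (Φ lam) - Real.log (partZ g (Φ lam)))
      - (β * Real.log (Φ β) - Real.log (partZ g (Φ β))) - Real.log (Φ β) * (lam - β) := by
  rw [Jfun, Real.log_div hZlam.ne' hZβ.ne']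
  rcases hlam with rfl | hlam
  · ring
  · rw [Real.log_div hlam.ne' hβ.ne']
    ring

lemma exists_abs_Mfun_le_mul_Jfun {g : ℕ → ℝ} {Φ Φ' : ℝ → ℝ} {b δ₀ δ₁ : ℝ}
    (hg : ∀ k, 0 < g (k + 1)) (hg0 : g 0 = 0) (hb : 0 < b) (hG : ∀ k : ℕ, g k ^ 2 ≤ b * k)
    (hΦ0 : Φ 0 = 0) (hnonneg : ∀ α, 0 ≤ α → 0 ≤ Φ α)
    (hsum : ∀ α, 0 ≤ α → ∃ r, Φ α < r ∧ Summable fun k : ℕ => r ^ k / gFact g k)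
    (hinv : ∀ α, 0 ≤ α → meanR g (Φ α) = α)
    (hderiv : ∀ α, 0 ≤ α → HasDerivAt Φ (Φ' α) α) (hderiv_pos : ∀ α, 0 ≤ α → 0 < Φ' α)
    (hcont : ContinuousOn Φ' (Ici 0)) (hδ₀ : 0 < δ₀) :
    ∃ C, 0 ≤ C ∧ ∀ β ∈ Icc δ₀ δ₁, ∀ lam, 0 ≤ lam →
      0 ≤ Jfun g Φ β lam ∧ |Mfun Φ Φ' lam β| ≤ C * Jfun g Φ β lam := by
  rcases lt_or_ge δ₁ δ₀ with hδ | hδ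
  · exact ⟨0, le_rfl, fun β hβ => absurd (hβ.1.trans hβ.2) (not_le.2 hδ)⟩
  have hpos : ∀ α, 0 < α → 0 < Φ α := fun α hα =>
    pos_of_meanR_eq (hnonneg α hα.le) hα (hinv α hα.le)
  have hZ1 : ∀ α, 0 ≤ α → 1 ≤ partZ g (Φ α) := fun α hα => by
    obtain ⟨r, hr, hs⟩ := hsum α hα
    exact one_le_partZ hg (hnonneg α hα)
      (summable_pow_div_gFact_of_le hg (hnonneg α hα) hr.le hs)
  have hsq : ∀ α, 0 ≤ α → Φ α ^ 2 ≤ b * α := fun α hα => by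
    obtain ⟨r, hr, hs⟩ := hsum α hα
    simpa only [hinv α hα] using sq_le_mul_meanR hg hg0 hG (hnonneg α hα) hr hs
  obtain ⟨hΦ1, hΦ'1⟩ := contDiffOn_inverse_meanR hg hpos hsum hinv hderiv hcont
  set G : ℝ → ℝ := fun x => x * Real.log (Φ x) - Real.log (partZ g (Φ x))
  have hGder : ∀ x ∈ Ioi (0 : ℝ), HasDerivAt G (Real.log (Φ x)) x := fun x hx => by
    obtain ⟨r, hr, hs⟩ := hsum x (le_of_lt hx)
    exact hasDerivAt_entropy hg (hpos x hx) hr hs (hinv x (le_of_lt hx)) (hderiv x (le_of_lt hx))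
  have hJ : ∀ β, 0 < β → ∀ lam, 0 ≤ lam →
      Jfun g Φ β lam = G lam - G β - Real.log (Φ β) * (lam - β) := fun β hβ lam hlam =>
    Jfun_eq_bregman (hpos β hβ) (hlam.eq_or_lt'.imp_right (hpos lam))
      (zero_lt_one.trans_le (hZ1 β hβ.le)) (zero_lt_one.trans_le (hZ1 lam hlam))
  have hlogder : ∀ x ∈ Ioi (0 : ℝ), HasDerivAt (fun x => Real.log (Φ x)) (Φ' x / Φ x) x :=
    fun x hx => (hderiv x (le_of_lt hx)).log (hpos x hx).ne'
  have hlogmono : ∀ {K : Set ℝ} {c : ℝ}, Convex ℝ K → K ⊆ Ioi 0 → (∀ x ∈ K, c ≤ Φ' x / Φ x) →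
      ∀ x ∈ K, ∀ y ∈ K, x ≤ y → c * (y - x) ≤ Real.log (Φ y) - Real.log (Φ x) := by
    intro K c hK hK0 hc
    refine hK.mul_sub_le_image_sub_of_le_deriv
      (fun x hx => (hlogder x (hK0 hx)).continuousAt.continuousWithinAt)
      (fun x hx => (hlogder x (hK0 (interior_subset hx))).differentiableAt.differentiableWithinAt)
      fun x hx => ?_
    rw [(hlogder x (hK0 (interior_subset hx))).deriv]
    exact hc x (interior_subset hx)
  have hJ0 : ∀ β, 0 < β → ∀ lam, 0 ≤ lam → 0 ≤ Jfun g Φ β lam := by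
    intro β hβ lam hlam
    rcases hlam.eq_or_lt with rfl | hlam
    · rw [Jfun, hΦ0, partZ_zero, one_div, Real.log_inv, zero_mul, zero_sub, neg_neg]
      exact Real.log_nonneg (hZ1 β hβ.le)
    · rw [hJ β hβ lam hlam.le]
      have := sq_le_bregman (c := 0) (convex_Ioi 0) hGder
        (hlogmono (convex_Ioi 0) subset_rfl fun x hx =>
          (div_pos (hderiv_pos x (le_of_lt hx)) (hpos x hx)).le) hβ hlam
      simpa using this
  set K : Set ℝ := Icc (δ₀ / 2) (δ₁ + 1)
  have hK0 : K ⊆ Ioi 0 := fun x hx => lt_of_lt_of_le (half_pos hδ₀) hx.1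
  have hKne : K.Nonempty := ⟨δ₀, by linarith, by linarith⟩
  have hKconv : Convex ℝ K := convex_Icc _ _
  obtain ⟨c, hc, hcK⟩ : ∃ c, 0 < c ∧ ∀ x ∈ K, c ≤ Φ' x / Φ x := by
    obtain ⟨x₀, hx₀, hmin⟩ := isCompact_Icc.exists_isMinOn hKne
      (((hΦ'1.continuousOn.mono hK0)).div (hΦ1.continuousOn.mono hK0)
        fun x hx => (hpos x (hK0 hx)).ne')
    exact ⟨_, div_pos (hderiv_pos x₀ (le_of_lt (hK0 hx₀))) (hpos x₀ (hK0 hx₀)), hmin⟩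
  have hlogK := hlogmono hKconv hK0 hcK
  have hpder : ∀ x ∈ K, HasDerivAt (fun x => Φ x ^ 2) (2 * Φ x * Φ' x) x := fun x hx => by
    simpa using (hderiv x (le_of_lt (hK0 hx))).fun_pow 2
  have hp'1 : ContDiffOn ℝ 1 (fun x => 2 * Φ x * Φ' x) (Ioi 0) :=
    (contDiffOn_const.mul hΦ1).mul hΦ'1
  obtain ⟨L, hL⟩ : ∃ L, ∀ x ∈ K, |deriv (fun x => 2 * Φ x * Φ' x) x| ≤ L :=
    isCompact_Icc.exists_bound_of_continuousOn
      ((hp'1.continuousOn_deriv_of_isOpen isOpen_Ioi le_rfl).mono hK0)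
  have hL0 : 0 ≤ L := (abs_nonneg _).trans (hL _ hKne.some_mem)
  have hp'cont : ContinuousOn (fun x => 2 * Φ x * Φ' x) K := hp'1.continuousOn.mono hK0
  have hp'diff : DifferentiableOn ℝ (fun x => 2 * Φ x * Φ' x) (interior K) :=
    (hp'1.differentiableOn one_ne_zero).mono (interior_subset.trans hK0)
  obtain ⟨P, hP⟩ : ∃ P, ∀ x ∈ K, |2 * Φ x * Φ' x| ≤ P :=
    isCompact_Icc.exists_bound_of_continuousOn hp'cont
  have hP0 : 0 ≤ P := (abs_nonneg _).trans (hP _ hKne.some_mem)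
  have hMnear : ∀ x ∈ K, ∀ y ∈ K, |Mfun Φ Φ' y x| ≤ L / 2 * (y - x) ^ 2 := by
    intro x hx y hy
    have hlow := sq_le_bregman (c := -L) hKconv hpder
      (hKconv.mul_sub_le_image_sub_of_le_deriv hp'cont hp'diff fun t ht =>
        (abs_le.1 (hL t (interior_subset ht))).1) hx hy
    have hupp := sq_le_bregman (c := -L) hKconv (fun t ht => (hpder t ht).fun_neg)
      (fun t ht u hu htu => by
        have := hKconv.image_sub_le_mul_sub_of_deriv_le hp'cont hp'diff
          (fun t ht => (abs_le.1 (hL t (interior_subset ht))).2) t ht u hu htu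
        linarith) hx hy
    rw [Mfun, abs_le]
    constructor <;> linarith
  have hJnear : ∀ x ∈ K, ∀ y ∈ K, c / 2 * (y - x) ^ 2 ≤ Jfun g Φ x y := by
    intro x hx y hy
    rw [hJ x (hK0 hx) y (le_of_lt (hK0 hy))]
    exact sq_le_bregman hKconv (fun t ht => hGder t (hK0 ht)) hlogK hx hy
  obtain ⟨η, hη, hη1, hη2⟩ : ∃ η : ℝ, 0 < η ∧ η ≤ 1 ∧ η ≤ δ₀ / 2 :=
    ⟨min 1 (δ₀ / 2), by positivity, min_le_left _ _, min_le_right _ _⟩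
  have hJthree : ∀ β z, 0 < β → 0 < z → ∀ lam, 0 ≤ lam → Jfun g Φ β lam =
      Jfun g Φ β z + Jfun g Φ z lam + (Real.log (Φ z) - Real.log (Φ β)) * (lam - z) := by
    intro β z hβ hz lam hlam
    rw [hJ β hβ lam hlam, hJ β hβ z hz.le, hJ z hz lam hlam]
    ring
  have hJfar : ∀ β ∈ Icc δ₀ δ₁, ∀ lam, 0 ≤ lam → η ≤ |lam - β| →
      c * η / 2 * |lam - β| ≤ Jfun g Φ β lam := by
    intro β hβ lam hlam hfar
    have hβK : β ∈ K := ⟨by linarith [hβ.1], by linarith [hβ.2]⟩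
    rcases le_total β lam with h | h
    · rw [abs_of_nonneg (sub_nonneg.2 h)] at hfar ⊢
      have hzK : β + η ∈ K := ⟨by linarith [hβ.1], by linarith [hβ.2]⟩
      rw [hJthree β (β + η) (hK0 hβK) (hK0 hzK) lam hlam]
      have h1 := hJnear β hβK _ hzK
      have h2 := hJ0 _ (hK0 hzK) lam hlam
      have h3 := mul_le_mul_of_nonneg_right (hlogK β hβK _ hzK (by linarith))
        (show 0 ≤ lam - (β + η) by linarith)
      nlinarith [mul_nonneg (mul_pos hc hη).le (show 0 ≤ lam - β - η by linarith)]
    · rw [abs_of_nonpos (sub_nonpos.2 h)] at hfar ⊢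
      have hzK : β - η ∈ K := ⟨by linarith [hβ.1], by linarith [hβ.2]⟩
      rw [hJthree β (β - η) (hK0 hβK) (hK0 hzK) lam hlam]
      have h1 := hJnear β hβK _ hzK
      have h2 := hJ0 _ (hK0 hzK) lam hlam
      have h3 := mul_le_mul_of_nonneg_right (hlogK _ hzK β hβK (by linarith))
        (show 0 ≤ β - η - lam by linarith)
      nlinarith [mul_nonneg (mul_pos hc hη).le (show 0 ≤ β - η - lam by linarith)]
  have hMfar : ∀ β ∈ Icc δ₀ δ₁, ∀ lam, 0 ≤ lam → η ≤ |lam - β| →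
      |Mfun Φ Φ' lam β| ≤ (b * (2 * δ₁ / η + 1) + P) * |lam - β| := by
    intro β hβ lam hlam hfar
    have hβ0 : 0 < β := hδ₀.trans_le hβ.1
    have hβK : β ∈ K := ⟨by linarith [hβ.1], by linarith [hβ.2]⟩
    have h1 : |Mfun Φ Φ' lam β| ≤ Φ lam ^ 2 + Φ β ^ 2 + P * |lam - β| := by
      have := abs_le.1 ((abs_mul (2 * Φ β * Φ' β) (lam - β)).trans_le
        (mul_le_mul_of_nonneg_right (hP β hβK) (abs_nonneg _)))
      rw [Mfun, abs_le]
      constructor <;> linarith [sq_nonneg (Φ lam), sq_nonneg (Φ β), this.1, this.2]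
    have h2 : 2 * δ₁ ≤ 2 * δ₁ / η * |lam - β| := by
      rw [div_mul_eq_mul_div, le_div_iff₀ hη]
      exact mul_le_mul_of_nonneg_left hfar (by linarith)
    have h3 : lam + β ≤ (2 * δ₁ / η + 1) * |lam - β| := by
      linarith [le_abs_self (lam - β), hβ.2]
    linarith [hsq lam hlam, hsq β hβ0.le, mul_le_mul_of_nonneg_left h3 hb.le]
  set A := b * (2 * δ₁ / η + 1) + P
  have hδ₁ : 0 < δ₁ := hδ₀.trans_le hδ
  have hA : 0 ≤ A := by positivity
  refine ⟨max (L / c) (A / (c * η / 2)), le_max_of_le_left (by positivity), ?_⟩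
  intro β hβ lam hlam
  have hJβ := hJ0 β (hδ₀.trans_le hβ.1) lam hlam
  refine ⟨hJβ, ?_⟩
  rcases le_total η |lam - β| with hfar | hnear
  · calc |Mfun Φ Φ' lam β| ≤ A * |lam - β| := hMfar β hβ lam hlam hfar
      _ = A / (c * η / 2) * (c * η / 2 * |lam - β|) := by field_simp
      _ ≤ A / (c * η / 2) * Jfun g Φ β lam :=
        mul_le_mul_of_nonneg_left (hJfar β hβ lam hlam hfar) (by positivity)
      _ ≤ _ := mul_le_mul_of_nonneg_right (le_max_right _ _) hJβ
  · have hβK : β ∈ K := ⟨by linarith [hβ.1], by linarith [hβ.2]⟩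
    have hlamK : lam ∈ K := by
      have := abs_le.1 hnear
      exact ⟨by linarith [hβ.1], by linarith [hβ.2]⟩
    calc |Mfun Φ Φ' lam β| ≤ L / 2 * (lam - β) ^ 2 := hMnear β hβK lam hlamK
      _ = L / c * (c / 2 * (lam - β) ^ 2) := by field_simp
      _ ≤ L / c * Jfun g Φ β lam :=
        mul_le_mul_of_nonneg_left (hJnear β hβK lam hlamK) (by positivity)
      _ ≤ _ := mul_le_mul_of_nonneg_right (le_max_left _ _) hJβ

theorem gamma_F_M_le_J
    (d : ℕ) (hd : 1 ≤ d)
    (g : ℕ → ℝ) (hg_nonneg : ∀ k, 0 ≤ g k) (hg_zero : ∀ k, g k = 0 ↔ k = 0)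
    (b : ℝ) (hb : 0 < b) (hG : ∀ k : ℕ, g k ^ 2 ≤ b * k)
    (psiStar : ENNReal) (hpsiStar : 0 < psiStar)
    (hrad : ∀ ψ : ℝ, 0 ≤ ψ → ENNReal.ofReal ψ < psiStar →
      Summable (fun k : ℕ => ψ ^ k / gFact g k))
    (hZinf : ∀ s : ℝ, ENNReal.ofReal s = psiStar →
      Filter.Tendsto (partZ g) (nhdsWithin s (Set.Iio s)) Filter.atTop)
    (Φ Φ' : ℝ → ℝ) (hΦ0 : Φ 0 = 0)
    (hΦ_range : ∀ α : ℝ, 0 ≤ α → 0 ≤ Φ α ∧ ENNReal.ofReal (Φ α) < psiStar)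
    (hΦ_inv : ∀ α : ℝ, 0 ≤ α → meanR g (Φ α) = α)
    (hΦ_deriv : ∀ α : ℝ, 0 ≤ α → HasDerivAt Φ (Φ' α) α ∧ 0 < Φ' α)
    (hΦ'_cont : ContinuousOn Φ' (Set.Ici 0))
    (T : ℝ) (hT : 0 < T)
    (F : ℝ → (Fin d → AddCircle (1 : ℝ)) → ℝ)
    (CF : ℝ) (hF_bdd : ∀ s u, |F s u| ≤ CF)
    (ρ : ℝ → (Fin d → AddCircle (1 : ℝ)) → ℝ)
    (δ₀ δ₁ : ℝ) (hδ₀ : 0 < δ₀) (hδ : δ₀ ≤ δ₁)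
    (hρ : ∀ s u, δ₀ ≤ ρ s u ∧ ρ s u ≤ δ₁) :
    ∃ γ₁ : ℝ, 0 < γ₁ ∧ ∀ γ : ℝ, 0 < γ → γ < γ₁ →
      ∀ s ∈ Set.Icc (0 : ℝ) T, ∀ u : Fin d → AddCircle (1 : ℝ), ∀ lam : ℝ, 0 ≤ lam →
        γ * F s u * Mfun Φ Φ' lam (ρ s u) - Jfun g Φ (ρ s u) lam ≤ 0 := by
  have hg : ∀ k, 0 < g (k + 1) := fun k =>
    (hg_nonneg _).lt_of_ne fun h => Nat.succ_ne_zero k ((hg_zero _).1 h.symm)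
  have hsum : ∀ α, 0 ≤ α → ∃ r, Φ α < r ∧ Summable fun k : ℕ => r ^ k / gFact g k := by
    intro α hα
    obtain ⟨q, hq, hq'⟩ := ENNReal.lt_iff_exists_nnreal_btwn.1 (hΦ_range α hα).2
    refine ⟨q, ?_, hrad q q.2 (by rwa [ENNReal.ofReal_coe_nnreal])⟩
    rw [← ENNReal.ofReal_coe_nnreal] at hq
    exact (ENNReal.ofReal_lt_ofReal_iff_of_nonneg (hΦ_range α hα).1).1 hq
  obtain ⟨C, hC, hCM⟩ := exists_abs_Mfun_le_mul_Jfun (δ₁ := δ₁) hg ((hg_zero 0).2 rfl) hb hG hΦ0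
    (fun α hα => (hΦ_range α hα).1) hsum hΦ_inv (fun α hα => (hΦ_deriv α hα).1)
    (fun α hα => (hΦ_deriv α hα).2) hΦ'_cont hδ₀
  have hCF : 0 ≤ CF := (abs_nonneg _).trans (hF_bdd 0 0)
  refine ⟨1 / (CF * C + 1), by positivity, fun γ hγ hγ₁ s _ u lam hlam => ?_⟩
  obtain ⟨hJ, hM⟩ := hCM (ρ s u) (hρ s u) lam hlam
  have hγC : γ * (CF * C) ≤ 1 := by
    rw [lt_div_iff₀ (by positivity)] at hγ₁
    linarith
  rw [sub_nonpos]
  calc γ * F s u * Mfun Φ Φ' lam (ρ s u)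
      ≤ |γ * F s u * Mfun Φ Φ' lam (ρ s u)| := le_abs_self _
    _ = γ * (|F s u| * |Mfun Φ Φ' lam (ρ s u)|) := by
      rw [abs_mul, abs_mul, abs_of_pos hγ, mul_assoc]
    _ ≤ γ * (CF * (C * Jfun g Φ (ρ s u) lam)) := by
      gcongr
      exact hF_bdd s u
    _ = γ * (CF * C) * Jfun g Φ (ρ s u) lam := by ring
    _ ≤ 1 * Jfun g Φ (ρ s u) lam := mul_le_mul_of_nonneg_right hγC hJ
    _ = Jfun g Φ (ρ s u) lam := one_mul _
end
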